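/- arXiv:math/0404381 — 3 statements merged into one kernel-verified Lean document; each statement's English description precedes it below -/
import Mathlib

section
/- If σ is a convolution-invertible left 2-cocycle on a Hopf algebra H (i.e., σ(h⊗1)=σ(1⊗h)=ε(h) and Σσ(k₁⊗m₁)σ(h⊗k₂m₂)=Σσ(h₁⊗k₁)σ(h₂k₂⊗m) for all h,k,m∈H), then for all h∈H one has Σ σ⁻¹(S(h₃)⊗h₄)·σ(h₁⊗S(h₂)) = ε(h). -/
open TensorProduct Coalgebra HopfAlgebra

noncomputable section

variable (k H : Type) [Field k] [Ring H] [HopfAlgebra k H]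

/-- Convolution product of two linear functionals on a coalgebra. -/
def conv {C : Type} [AddCommGroup C] [Module k C] [Coalgebra k C]
    (f g : C →ₗ[k] k) : C →ₗ[k] k :=
  LinearMap.mul' k k ∘ₗ TensorProduct.map f g ∘ₗ Coalgebra.comul

variable {k H}

/-- `h ⊗ k ⊗ m ↦ ε(h)·σ(k ⊗ m)`. -/
def p23 (σ : H ⊗[k] H →ₗ[k] k) : H ⊗[k] (H ⊗[k] H) →ₗ[k] k :=
  σ ∘ₗ (TensorProduct.lid k (H ⊗[k] H)).toLinearMap ∘ₗ
    TensorProduct.map Coalgebra.counit LinearMap.id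

/-- `h ⊗ k ⊗ m ↦ σ(h ⊗ km)`. -/
def p1_23 (σ : H ⊗[k] H →ₗ[k] k) : H ⊗[k] (H ⊗[k] H) →ₗ[k] k :=
  σ ∘ₗ TensorProduct.map LinearMap.id (LinearMap.mul' k H)

/-- `h ⊗ k ⊗ m ↦ σ(h ⊗ k)·ε(m)`. -/
def p12 (σ : H ⊗[k] H →ₗ[k] k) : H ⊗[k] (H ⊗[k] H) →ₗ[k] k :=
  σ ∘ₗ TensorProduct.map LinearMap.id
    ((TensorProduct.rid k H).toLinearMap ∘ₗ TensorProduct.map LinearMap.id Coalgebra.counit)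

/-- `h ⊗ k ⊗ m ↦ σ(hk ⊗ m)`. -/
def p12_3 (σ : H ⊗[k] H →ₗ[k] k) : H ⊗[k] (H ⊗[k] H) →ₗ[k] k :=
  σ ∘ₗ TensorProduct.map (LinearMap.mul' k H) LinearMap.id ∘ₗ
    (TensorProduct.assoc k H H H).symm.toLinearMap

/-- σ is a (normalized) left 2-cocycle:
`σ(h⊗1)=σ(1⊗h)=ε(h)` and `Σσ(k₁⊗m₁)σ(h⊗k₂m₂)=Σσ(h₁⊗k₁)σ(h₂k₂⊗m)`. -/
def IsLeftCocycle (σ : H ⊗[k] H →ₗ[k] k) : Prop :=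
  (∀ h : H, σ (h ⊗ₜ 1) = Coalgebra.counit h ∧ σ ((1 : H) ⊗ₜ h) = Coalgebra.counit h) ∧
  conv k (p23 σ) (p1_23 σ) = conv k (p12 σ) (p12_3 σ)

/-- σ' is a convolution inverse of σ. -/
def IsConvInverse (σ σ' : H ⊗[k] H →ₗ[k] k) : Prop :=
  conv k σ σ' = Coalgebra.counit ∧ conv k σ' σ = Coalgebra.counit

namespace Cocycle

open LinearMap WithConv Algebra.TensorProduct

section Convolution

variable {C A B : Type} [AddCommGroup C] [Module k C] [Coalgebra k C]
  [Semiring A] [Algebra k A] [Semiring B] [Algebra k B]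

lemma conv_eq (f g : C →ₗ[k] k) : conv k f g = (toConv f * toConv g).ofConv := rfl

lemma toConv_counit : toConv (Coalgebra.counit : C →ₗ[k] k) = 1 := rfl

lemma conv_comp_coalgHom {D : Type} [AddCommGroup D] [Module k D] [Coalgebra k D]
    (f g : C →ₗ[k] k) (φ : D →ₗc[k] C) :
    conv k f g ∘ₗ φ.toLinearMap = conv k (f ∘ₗ φ.toLinearMap) (g ∘ₗ φ.toLinearMap) :=
  convMul_comp_coalgHom_distrib (toConv f) (toConv g) φ

lemma conv_comp_coalgHom_eq_counit {D : Type} [AddCommGroup D] [Module k D] [Coalgebra k D]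
    {f g : C →ₗ[k] k} (h : conv k f g = Coalgebra.counit) (φ : D →ₗc[k] C) :
    conv k (f ∘ₗ φ.toLinearMap) (g ∘ₗ φ.toLinearMap) = Coalgebra.counit := by
  rw [← conv_comp_coalgHom, h]
  exact φ.counit_comp

lemma algHom_comp_mul (φ : A →ₐ[k] B) (f g : WithConv (C →ₗ[k] A)) :
    toConv (φ.toLinearMap ∘ₗ (f * g).ofConv) =
      toConv (φ.toLinearMap ∘ₗ f.ofConv) * toConv (φ.toLinearMap ∘ₗ g.ofConv) :=
  congrArg toConv (algHom_comp_convMul_distrib φ f g)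

lemma algHom_comp_one (φ : A →ₐ[k] B) :
    toConv (φ.toLinearMap ∘ₗ (1 : WithConv (C →ₗ[k] A)).ofConv) = 1 := by
  ext c; simp [LinearMap.convOne_def]

lemma mul_apply_repr (f g : WithConv (C →ₗ[k] A)) (c : C) :
    (f * g) c = ∑ i ∈ (ℛ k c).index, f ((ℛ k c).left i) * g ((ℛ k c).right i) :=
  (ℛ k c).convMul_apply f g

/-- A linear map carrying sixfold products to sixfold products carries sixfold convolution
products to sixfold convolution products. -/
lemma comp_conv_six (Φ : A →ₗ[k] B) (f₁ f₂ f₃ f₄ f₅ f₆ : WithConv (C →ₗ[k] A))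
    (g₁ g₂ g₃ g₄ g₅ g₆ : WithConv (C →ₗ[k] B))
    (h : ∀ x₁ x₂ x₃ x₄ x₅ x₆, Φ (f₁ x₁ * (f₂ x₂ * (f₃ x₃ * (f₄ x₄ * (f₅ x₅ * f₆ x₆))))) =
      g₁ x₁ * (g₂ x₂ * (g₃ x₃ * (g₄ x₄ * (g₅ x₅ * g₆ x₆))))) (c : C) :
    Φ ((f₁ * (f₂ * (f₃ * (f₄ * (f₅ * f₆))))) c) =
      (g₁ * (g₂ * (g₃ * (g₄ * (g₅ * g₆))))) c := by
  simp only [mul_apply_repr, Finset.mul_sum, map_sum, h]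

end Convolution

section Antipode

variable {A : Type} [Semiring A] [Algebra k A]

/-- An algebra map out of `H` composed with the antipode. -/
def anti (φ : H →ₐ[k] A) : WithConv (H →ₗ[k] A) :=
  toConv (φ.toLinearMap ∘ₗ HopfAlgebra.antipode k)

/-- An algebra map out of `H` as an element of the convolution algebra. -/
def lin (φ : H →ₐ[k] A) : WithConv (H →ₗ[k] A) := toConv φ.toLinearMap

@[simp] lemma anti_apply (φ : H →ₐ[k] A) (h : H) : anti φ h = φ (HopfAlgebra.antipode k h) := rfl

@[simp] lemma lin_apply (φ : H →ₐ[k] A) (h : H) : lin φ h = φ h := rfl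

lemma anti_mul_lin (φ : H →ₐ[k] A) : anti φ * lin φ = 1 := by
  have := algHom_comp_mul φ (toConv (HopfAlgebra.antipode k (A := H))) (toConv LinearMap.id)
  rw [LinearMap.antipode_mul_id, algHom_comp_one] at this
  exact this.symm

lemma lin_mul_anti (φ : H →ₐ[k] A) : lin φ * anti φ = 1 := by
  have := algHom_comp_mul φ (toConv LinearMap.id) (toConv (HopfAlgebra.antipode k (A := H)))
  rw [LinearMap.id_mul_antipode, algHom_comp_one] at this
  exact this.symm

lemma map_comul_eq {B : Type} [Semiring B] [Algebra k B] (φ : H →ₗ[k] A) (ψ : H →ₗ[k] B) :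
    toConv (TensorProduct.map φ ψ ∘ₗ Coalgebra.comul) =
      toConv ((includeLeft : A →ₐ[k] A ⊗[k] B).toLinearMap ∘ₗ φ) *
        toConv ((includeRight : B →ₐ[k] A ⊗[k] B).toLinearMap ∘ₗ ψ) := by
  rw [LinearMap.convMul_def]
  congr 1
  simp only [← LinearMap.comp_assoc]
  congr 1
  ext; simp

/-- Composition with the antipode reverses convolution products of algebra maps. -/
lemma anti_eq_mul_of_lin_eq_mul (φ : H →ₐ[k] A) (α β : H →ₐ[k] A) (hφ : lin φ = lin α * lin β) :
    anti φ = anti β * anti α := by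
  refine left_inv_eq_right_inv (anti_mul_lin φ) ?_
  rw [hφ, mul_assoc, ← mul_assoc (lin β), lin_mul_anti, one_mul, lin_mul_anti]

end Antipode

section Slots

variable (k H) in
/-- Inclusion of the first factor of `H ⊗ H`. -/
def j₁ : H →ₐ[k] H ⊗[k] H := includeLeft

variable (k H) in
/-- Inclusion of the second factor of `H ⊗ H`. -/
def j₂ : H →ₐ[k] H ⊗[k] H := includeRight

variable (k H) in
/-- Inclusion of the first factor of `H ⊗ (H ⊗ H)`. -/
def i₁ : H →ₐ[k] H ⊗[k] (H ⊗[k] H) := includeLeft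

variable (k H) in
/-- Inclusion of the second factor of `H ⊗ (H ⊗ H)`. -/
def i₂ : H →ₐ[k] H ⊗[k] (H ⊗[k] H) := includeRight.comp (j₁ k H)

variable (k H) in
/-- Inclusion of the third factor of `H ⊗ (H ⊗ H)`. -/
def i₃ : H →ₐ[k] H ⊗[k] (H ⊗[k] H) := includeRight.comp (j₂ k H)

variable {A : Type} [Semiring A] [Algebra k A]

/-- `φ` into the left factor. -/
def inL (φ : H →ₐ[k] A) : H →ₐ[k] A ⊗[k] A := includeLeft.comp φ

/-- `φ` into the right factor. -/
def inR (φ : H →ₐ[k] A) : H →ₐ[k] A ⊗[k] A := includeRight.comp φ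

@[simp] lemma j₁_apply (h : H) : j₁ k H h = h ⊗ₜ 1 := rfl
@[simp] lemma j₂_apply (h : H) : j₂ k H h = 1 ⊗ₜ h := rfl
@[simp] lemma i₁_apply (h : H) : i₁ k H h = h ⊗ₜ 1 := rfl
@[simp] lemma i₂_apply (h : H) : i₂ k H h = 1 ⊗ₜ (h ⊗ₜ 1) := rfl
@[simp] lemma i₃_apply (h : H) : i₃ k H h = 1 ⊗ₜ (1 ⊗ₜ h) := rfl
@[simp] lemma inL_apply (φ : H →ₐ[k] A) (h : H) : inL φ h = φ h ⊗ₜ 1 := rfl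
@[simp] lemma inR_apply (φ : H →ₐ[k] A) (h : H) : inR φ h = 1 ⊗ₜ φ h := rfl

/-- If `φ` is compatible with comultiplication, then `Δ ∘ φ` is the convolution product of the
two inclusions of `φ`. -/
lemma lin_comul_comp {A : Type} [Semiring A] [Bialgebra k A] (φ : H →ₐ[k] A)
    (hφ : ∀ h, Coalgebra.comul (R := k) (φ h) =
      TensorProduct.map φ.toLinearMap φ.toLinearMap (Coalgebra.comul h)) :
    lin ((Bialgebra.comulAlgHom k A).comp φ) = lin (inL φ) * lin (inR φ) := by
  have := map_comul_eq (k := k) (H := H) φ.toLinearMap φ.toLinearMap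
  refine Eq.trans ?_ this
  ext h
  exact hφ h

lemma comul_i₁ : lin ((Bialgebra.comulAlgHom k (H ⊗[k] (H ⊗[k] H))).comp (i₁ k H)) =
    lin (inL (i₁ k H)) * lin (inR (i₁ k H)) := by
  refine lin_comul_comp _ fun h => ?_
  simp only [i₁_apply, TensorProduct.comul_tmul, Bialgebra.comul_one, one_def]
  induction Coalgebra.comul (R := k) h with
  | zero => simp
  | add x y hx hy => simp only [TensorProduct.add_tmul, map_add, hx, hy]
  | tmul x y => simp [one_def]

lemma comul_i₂ : lin ((Bialgebra.comulAlgHom k (H ⊗[k] (H ⊗[k] H))).comp (i₂ k H)) =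
    lin (inL (i₂ k H)) * lin (inR (i₂ k H)) := by
  refine lin_comul_comp _ fun h => ?_
  simp only [i₂_apply, TensorProduct.comul_tmul, Bialgebra.comul_one, one_def]
  induction Coalgebra.comul (R := k) h with
  | zero => simp
  | add x y hx hy => simp only [TensorProduct.add_tmul, TensorProduct.tmul_add, map_add, hx, hy]
  | tmul x y => simp

lemma comul_i₃ : lin ((Bialgebra.comulAlgHom k (H ⊗[k] (H ⊗[k] H))).comp (i₃ k H)) =
    lin (inL (i₃ k H)) * lin (inR (i₃ k H)) := by
  refine lin_comul_comp _ fun h => ?_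
  simp only [i₃_apply, TensorProduct.comul_tmul, Bialgebra.comul_one, one_def]
  induction Coalgebra.comul (R := k) h with
  | zero => simp
  | add x y hx hy => simp only [TensorProduct.tmul_add, map_add, hx, hy]
  | tmul x y => simp

variable (k H) in
/-- `h ↦ h₁ ⊗ S(h₂) ⊗ h₃`. -/
def testMap : WithConv (H →ₗ[k] H ⊗[k] (H ⊗[k] H)) :=
  lin (i₁ k H) * (anti (i₂ k H) * lin (i₃ k H))

lemma comul_testMap (h : H) : Coalgebra.comul (R := k) (testMap k H h) =
    (lin (inL (i₁ k H)) * (lin (inR (i₁ k H)) * (anti (inR (i₂ k H)) * (anti (inL (i₂ k H)) *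
      (lin (inL (i₃ k H)) * lin (inR (i₃ k H))))))) h := by
  have e : toConv ((Bialgebra.comulAlgHom k (H ⊗[k] (H ⊗[k] H))).toLinearMap ∘ₗ
      (testMap k H).ofConv) =
      lin ((Bialgebra.comulAlgHom k _).comp (i₁ k H)) *
        (anti ((Bialgebra.comulAlgHom k _).comp (i₂ k H)) *
          lin ((Bialgebra.comulAlgHom k _).comp (i₃ k H))) := by
    rw [testMap, algHom_comp_mul, algHom_comp_mul]
    rfl
  rw [comul_i₁, anti_eq_mul_of_lin_eq_mul _ _ _ comul_i₂, comul_i₃] at e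
  simp only [mul_assoc] at e
  rw [← e]
  rfl

end Slots

section Cocycle

lemma p23_eq (σ : H ⊗[k] H →ₗ[k] k) : p23 σ = σ ∘ₗ
    ((Coalgebra.TensorProduct.lid k (H ⊗[k] H)).toCoalgHom.comp
      (Coalgebra.TensorProduct.map (Coalgebra.counitCoalgHom k H)
        (CoalgHom.id k (H ⊗[k] H)))).toLinearMap := rfl

lemma p12_3_eq (σ : H ⊗[k] H →ₗ[k] k) : p12_3 σ = σ ∘ₗ
    ((Coalgebra.TensorProduct.map (Bialgebra.mulCoalgHom k H) (CoalgHom.id k H)).comp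
      (Coalgebra.TensorProduct.assoc k k H H H).symm.toCoalgHom).toLinearMap := rfl

lemma conv_p1_23_p12_3 {σ σ' : H ⊗[k] H →ₗ[k] k}
    (hσ : IsLeftCocycle σ) (hσ' : IsConvInverse σ σ') :
    conv k (p1_23 σ) (p12_3 σ') = conv k (p23 σ') (p12 σ) := by
  have h₁ : toConv (p23 σ') * toConv (p23 σ) = 1 := by
    rw [p23_eq, p23_eq]
    exact congrArg toConv (conv_comp_coalgHom_eq_counit hσ'.2 _)
  have h₂ : toConv (p12_3 σ) * toConv (p12_3 σ') = 1 := by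
    rw [p12_3_eq, p12_3_eq]
    exact congrArg toConv (conv_comp_coalgHom_eq_counit hσ'.1 _)
  have h : toConv (p23 σ) * toConv (p1_23 σ) = toConv (p12 σ) * toConv (p12_3 σ) :=
    congrArg toConv hσ.2
  rw [conv_eq, conv_eq]
  congr 1
  calc toConv (p1_23 σ) * toConv (p12_3 σ')
      = toConv (p23 σ') * (toConv (p23 σ) * toConv (p1_23 σ)) * toConv (p12_3 σ') := by
        rw [← mul_assoc, h₁, one_mul]
    _ = toConv (p23 σ') * toConv (p12 σ) := by
        rw [h, mul_assoc, mul_assoc, h₂, mul_one]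

lemma convInverse_one_tmul {σ σ' : H ⊗[k] H →ₗ[k] k}
    (hσ : IsLeftCocycle σ) (hσ' : IsConvInverse σ σ') (h : H) :
    σ' (1 ⊗ₜ h) = Coalgebra.counit h := by
  have e : ∀ x : H ⊗[k] H, LinearMap.mul' k k (TensorProduct.map σ σ'
      (AlgebraTensorModule.tensorTensorTensorComm k k k k H H H H ((1 ⊗ₜ 1) ⊗ₜ x))) =
      σ' (1 ⊗ₜ TensorProduct.lid k H (Coalgebra.counit.rTensor H x)) := by
    intro x
    induction x with
    | zero => simp
    | add x y hx hy => simp only [TensorProduct.tmul_add, map_add, hx, hy]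
    | tmul x y => simp [(hσ.1 x).2]
  have hinv := LinearMap.congr_fun hσ'.1 (1 ⊗ₜ h)
  simp only [conv, LinearMap.comp_apply, TensorProduct.comul_tmul, Bialgebra.comul_one, one_def,
    e, Coalgebra.rTensor_counit_comul] at hinv
  simpa using hinv

/-- `(x ⊗ y ⊗ z) ⊗ (x' ⊗ y' ⊗ z') ↦ (x ⊗ yz) ⊗ (x'y' ⊗ z')`. -/
def mulSlots : (H ⊗[k] (H ⊗[k] H)) ⊗[k] (H ⊗[k] (H ⊗[k] H)) →ₗ[k]
    (H ⊗[k] H) ⊗[k] (H ⊗[k] H) :=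
  TensorProduct.map (TensorProduct.map LinearMap.id (LinearMap.mul' k H))
    (TensorProduct.map (LinearMap.mul' k H) LinearMap.id ∘ₗ
      (TensorProduct.assoc k H H H).symm.toLinearMap)

/-- `(x ⊗ y ⊗ z) ⊗ (x' ⊗ y' ⊗ z') ↦ ε(x)ε(z') (y ⊗ z) ⊗ (x' ⊗ y')`. -/
def counitSlots : (H ⊗[k] (H ⊗[k] H)) ⊗[k] (H ⊗[k] (H ⊗[k] H)) →ₗ[k]
    (H ⊗[k] H) ⊗[k] (H ⊗[k] H) :=
  TensorProduct.map
    ((TensorProduct.lid k (H ⊗[k] H)).toLinearMap ∘ₗ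
      TensorProduct.map Coalgebra.counit LinearMap.id)
    (TensorProduct.map LinearMap.id
      ((TensorProduct.rid k H).toLinearMap ∘ₗ TensorProduct.map LinearMap.id Coalgebra.counit))

lemma mulSlots_comul (h : H) : mulSlots (Coalgebra.comul (R := k) (testMap k H h)) =
    (lin (inL (j₁ k H)) * lin (inR (j₂ k H))) h := by
  rw [comul_testMap]
  refine (comp_conv_six (A := (H ⊗[k] (H ⊗[k] H)) ⊗[k] (H ⊗[k] (H ⊗[k] H)))
    (B := (H ⊗[k] H) ⊗[k] (H ⊗[k] H)) mulSlots _ _ _ _ _ _ (lin (inL (j₁ k H))) (lin (inR (j₁ k H)))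
    (anti (inR (j₁ k H))) (anti (inL (j₂ k H))) (lin (inL (j₂ k H))) (lin (inR (j₂ k H)))
    ?_ h).trans ?_
  · intros
    simp [mulSlots, one_def]
  · rw [← mul_assoc (anti (inL _)), anti_mul_lin, one_mul, ← mul_assoc (lin (inR _)),
      lin_mul_anti, one_mul]

lemma counitSlots_comul (h : H) : counitSlots (Coalgebra.comul (R := k) (testMap k H h)) =
    ((lin (inR (j₁ k H)) * anti (inR (j₂ k H))) *
      (anti (inL (j₁ k H)) * lin (inL (j₂ k H)))) h := by
  rw [comul_testMap]
  refine (comp_conv_six (A := (H ⊗[k] (H ⊗[k] H)) ⊗[k] (H ⊗[k] (H ⊗[k] H)))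
    (B := (H ⊗[k] H) ⊗[k] (H ⊗[k] H)) counitSlots _ _ _ _ _ _ 1 (lin (inR (j₁ k H)))
    (anti (inR (j₂ k H))) (anti (inL (j₁ k H))) (lin (inL (j₂ k H))) 1
    ?_ h).trans ?_
  · intros
    simp [counitSlots, one_def, Algebra.algebraMap_eq_smul_one, ← TensorProduct.smul_tmul', smul_smul]
  · simp only [one_mul, mul_one, mul_assoc]

/-- Two functionals on the factors, applied to a convolution product with values in the
respective factors. -/
lemma map_includeLeft_mul_includeRight {C A : Type} [AddCommGroup C] [Module k C] [Coalgebra k C]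
    [Semiring A] [Algebra k A] (f g : A →ₗ[k] k) (u v : C →ₗ[k] A) (c : C) :
    LinearMap.mul' k k (TensorProduct.map f g
      ((toConv ((includeLeft : A →ₐ[k] A ⊗[k] A).toLinearMap ∘ₗ u) *
        toConv ((includeRight : A →ₐ[k] A ⊗[k] A).toLinearMap ∘ₗ v)) c)) =
      conv k (f ∘ₗ u) (g ∘ₗ v) c := by
  rw [conv_eq]
  change _ = (toConv (f ∘ₗ u) * toConv (g ∘ₗ v)) c
  simp only [mul_apply_repr, map_sum]
  simp

lemma map_includeRight_mul_includeLeft {C A : Type} [AddCommGroup C] [Module k C] [Coalgebra k C]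
    [Semiring A] [Algebra k A] (f g : A →ₗ[k] k) (u v : C →ₗ[k] A) (c : C) :
    LinearMap.mul' k k (TensorProduct.map f g
      ((toConv ((includeRight : A →ₐ[k] A ⊗[k] A).toLinearMap ∘ₗ u) *
        toConv ((includeLeft : A →ₐ[k] A ⊗[k] A).toLinearMap ∘ₗ v)) c)) =
      conv k (g ∘ₗ u) (f ∘ₗ v) c := by
  rw [conv_eq]
  change _ = (toConv (g ∘ₗ u) * toConv (f ∘ₗ v)) c
  simp only [mul_apply_repr, map_sum]
  simp [mul_comm]

lemma conv_p1_23_p12_3_apply (σ σ' : H ⊗[k] H →ₗ[k] k) (h : H) :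
    conv k (p1_23 σ) (p12_3 σ') (testMap k H h) =
      conv k (σ ∘ₗ (j₁ k H).toLinearMap) (σ' ∘ₗ (j₂ k H).toLinearMap) h := by
  rw [← map_includeLeft_mul_includeRight]
  refine Eq.trans ?_ (congrArg (fun x => LinearMap.mul' k k (TensorProduct.map σ σ' x))
    (mulSlots_comul h))
  simp only [conv, p1_23, p12_3, mulSlots, LinearMap.comp_apply, TensorProduct.map_comp]

lemma conv_p23_p12_apply (σ σ' : H ⊗[k] H →ₗ[k] k) (h : H) :
    conv k (p23 σ') (p12 σ) (testMap k H h) =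
      conv k
        (σ ∘ₗ TensorProduct.map LinearMap.id (HopfAlgebra.antipode (R := k)) ∘ₗ Coalgebra.comul)
        (σ' ∘ₗ TensorProduct.map (HopfAlgebra.antipode (R := k)) LinearMap.id ∘ₗ Coalgebra.comul)
        h := by
  rw [← map_includeRight_mul_includeLeft]
  have e₁ := algHom_comp_mul (includeRight : _ →ₐ[k] (H ⊗[k] H) ⊗[k] (H ⊗[k] H))
    (lin (j₁ k H)) (anti (j₂ k H))
  have e₂ := algHom_comp_mul (includeLeft : _ →ₐ[k] (H ⊗[k] H) ⊗[k] (H ⊗[k] H))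
    (anti (j₁ k H)) (lin (j₂ k H))
  have m₁ := map_comul_eq (k := k) (H := H) LinearMap.id (HopfAlgebra.antipode k)
  have m₂ := map_comul_eq (k := k) (H := H) (HopfAlgebra.antipode k) LinearMap.id
  have key := counitSlots_comul (k := k) h
  replace e₁ : _ = lin (inR (j₁ k H)) * anti (inR (j₂ k H)) := e₁
  replace e₂ : _ = anti (inL (j₁ k H)) * lin (inL (j₂ k H)) := e₂
  replace m₁ : _ = lin (j₁ k H) * anti (j₂ k H) := m₁
  replace m₂ : _ = anti (j₁ k H) * lin (j₂ k H) := m₂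
  rw [← e₁, ← e₂, ← m₁, ← m₂] at key
  refine Eq.trans ?_ (congrArg (fun x => LinearMap.mul' k k (TensorProduct.map σ' σ x)) key)
  simp only [conv, p23, p12, counitSlots, LinearMap.comp_apply, TensorProduct.map_comp]

end Cocycle

end Cocycle

/-- `Σ σ⁻¹(S(h₃)⊗h₄)·σ(h₁⊗S(h₂)) = ε(h)`, expressed as the convolution
identity `(σ∘(id⊗S)∘Δ) * (σ⁻¹∘(S⊗id)∘Δ) = ε` of functionals on `H`. -/
theorem stmt0 (σ σ' : H ⊗[k] H →ₗ[k] k)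
    (hσ : IsLeftCocycle σ) (hσ' : IsConvInverse σ σ') :
    conv k
      (σ ∘ₗ TensorProduct.map LinearMap.id (HopfAlgebra.antipode (R := k)) ∘ₗ Coalgebra.comul)
      (σ' ∘ₗ TensorProduct.map (HopfAlgebra.antipode (R := k)) LinearMap.id ∘ₗ Coalgebra.comul)
      = Coalgebra.counit := by
  ext h
  rw [← Cocycle.conv_p23_p12_apply, ← Cocycle.conv_p1_23_p12_3 hσ hσ',
    Cocycle.conv_p1_23_p12_3_apply]
  have e₁ : σ ∘ₗ (Cocycle.j₁ k H).toLinearMap = Coalgebra.counit :=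
    LinearMap.ext fun x => (hσ.1 x).1
  have e₂ : σ' ∘ₗ (Cocycle.j₂ k H).toLinearMap = Coalgebra.counit :=
    LinearMap.ext (Cocycle.convInverse_one_tmul hσ hσ')
  rw [e₁, e₂, Cocycle.conv_eq, Cocycle.toConv_counit, one_mul]
  rfl
end
end

section
/- Let σ be a convolution-invertible left 2-cocycle on a Hopf algebra H with bijective antipode S. Then for all h∈H one has Σ σ⁻¹(h₄⊗S⁻¹(h₃))·σ(S⁻¹(h₂)⊗h₁) = ε(h). -/
open TensorProduct Coalgebra HopfAlgebra

noncomputable section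

variable (k H : Type) [Field k] [Ring H] [HopfAlgebra k H]

variable {k H}

/-- `h ⊗ k ⊗ m ↦ σ(h ⊗ m)·ε(k)`. -/
def p13 (σ : H ⊗[k] H →ₗ[k] k) : H ⊗[k] (H ⊗[k] H) →ₗ[k] k :=
  σ ∘ₗ TensorProduct.map LinearMap.id
    ((TensorProduct.lid k H).toLinearMap ∘ₗ TensorProduct.map Coalgebra.counit LinearMap.id)

/-- Iterated comultiplication `h ↦ h₁ ⊗ (h₂ ⊗ h₃)`. -/
def Delta3 : H →ₗ[k] H ⊗[k] (H ⊗[k] H) :=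
  TensorProduct.map LinearMap.id Coalgebra.comul ∘ₗ Coalgebra.comul

/-- The twisted product of `A_σ`: `h ⊗ k ↦ h·k = Σ σ(k₁⊗h₁) k₂h₂`. -/
def tmul (σ : H ⊗[k] H →ₗ[k] k) : H ⊗[k] H →ₗ[k] H :=
  (TensorProduct.lid k H).toLinearMap ∘ₗ
    TensorProduct.map (σ ∘ₗ (TensorProduct.comm k H H).toLinearMap)
      (LinearMap.mul' k H ∘ₗ (TensorProduct.comm k H H).toLinearMap) ∘ₗ
    (TensorProduct.tensorTensorTensorComm k H H H H).toLinearMap ∘ₗ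
    TensorProduct.map Coalgebra.comul Coalgebra.comul

/-- `(h₁ ⊗ ((h₂ ⊗ h₃) ⊗ h₄))`, computed from `h₁₁ ⊗ h₁₂ ⊗ h₂₁ ⊗ h₂₂`. -/
lemma comul_comul_comul {C : Type} [AddCommGroup C] [Module k C] [Coalgebra k C] :
    (TensorProduct.assoc k C C C).symm.toLinearMap.lTensor C ∘ₗ
      (TensorProduct.assoc k C C (C ⊗[k] C)).toLinearMap ∘ₗ
      TensorProduct.map comul comul ∘ₗ (comul : C →ₗ[k] C ⊗[k] C) =
    (comul.rTensor C ∘ₗ comul).lTensor C ∘ₗ comul := by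
  have h₁ : (TensorProduct.map comul comul : C ⊗[k] C →ₗ[k] _) =
      comul.lTensor _ ∘ₗ comul.rTensor C := by ext; simp
  have h₂ : (TensorProduct.assoc k C C (C ⊗[k] C)).toLinearMap ∘ₗ comul.lTensor _ =
      (comul.lTensor C).lTensor C ∘ₗ (TensorProduct.assoc k C C C).toLinearMap := by
    ext; simp
  rw [h₁, LinearMap.comp_assoc,
    ← LinearMap.comp_assoc _ _ (TensorProduct.assoc k C C _).toLinearMap,
    h₂, LinearMap.comp_assoc, coassoc, ← LinearMap.comp_assoc comul,
    ← LinearMap.lTensor_comp, ← LinearMap.comp_assoc, ← LinearMap.lTensor_comp,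
    coassoc_symm]

lemma sum_comul_comul {C V : Type} [AddCommGroup C] [Module k C] [Coalgebra k C]
    [AddCommGroup V] [Module k V] (P : C ⊗[k] ((C ⊗[k] C) ⊗[k] C) →ₗ[k] V) (a : C) :
    ∑ i ∈ (ℛ k a).index, ∑ j ∈ (ℛ k ((ℛ k a).left i)).index,
      ∑ l ∈ (ℛ k ((ℛ k a).right i)).index,
        P ((ℛ k ((ℛ k a).left i)).left j ⊗ₜ (((ℛ k ((ℛ k a).left i)).right j ⊗ₜ
          (ℛ k ((ℛ k a).right i)).left l) ⊗ₜ (ℛ k ((ℛ k a).right i)).right l)) =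
    ∑ i ∈ (ℛ k a).index, ∑ j ∈ (ℛ k ((ℛ k a).right i)).index,
        P ((ℛ k a).left i ⊗ₜ (comul ((ℛ k ((ℛ k a).right i)).left j) ⊗ₜ
          (ℛ k ((ℛ k a).right i)).right j)) := by
  have h := congr(P ($(comul_comul_comul (k := k) (C := C)) a))
  simp only [LinearMap.comp_apply, LinearEquiv.coe_coe] at h
  rw [← (ℛ k a).eq] at h
  simp only [map_sum, TensorProduct.map_tmul, LinearMap.lTensor_tmul, LinearMap.comp_apply] at h
  convert h using 3 with i _ i _
  · conv_rhs => rw [← (ℛ k ((ℛ k a).left i)).eq, ← (ℛ k ((ℛ k a).right i)).eq]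
    simp only [TensorProduct.sum_tmul, TensorProduct.tmul_sum, map_sum]
    rw [Finset.sum_comm]
    simp
  · rw [← (ℛ k ((ℛ k a).right i)).eq]
    simp [TensorProduct.tmul_sum]

/-- If `m (h₁ ⊗ h₂) = ε(h)`, then `h₁ ⊗ m (h₂ ⊗ h₃) ⊗ h₄ = h₁ ⊗ 1 ⊗ h₂`. -/
lemma sum_comul_comul_collapse {C A V : Type} [AddCommGroup C] [Module k C] [Coalgebra k C]
    [Ring A] [Algebra k A]
    [AddCommGroup V] [Module k V] (m : C ⊗[k] C →ₗ[k] A)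
    (hm : m ∘ₗ comul = Algebra.linearMap k A ∘ₗ counit)
    (P : C ⊗[k] (A ⊗[k] C) →ₗ[k] V) (a : C) :
    ∑ i ∈ (ℛ k a).index, ∑ j ∈ (ℛ k ((ℛ k a).left i)).index,
      ∑ l ∈ (ℛ k ((ℛ k a).right i)).index,
        P ((ℛ k ((ℛ k a).left i)).left j ⊗ₜ (m ((ℛ k ((ℛ k a).left i)).right j ⊗ₜ
          (ℛ k ((ℛ k a).right i)).left l) ⊗ₜ (ℛ k ((ℛ k a).right i)).right l)) =
    ∑ i ∈ (ℛ k a).index, P ((ℛ k a).left i ⊗ₜ (1 ⊗ₜ (ℛ k a).right i)) := by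
  have h := sum_comul_comul (P ∘ₗ (m.rTensor C).lTensor C) a
  simp only [LinearMap.comp_apply, LinearMap.lTensor_tmul, LinearMap.rTensor_tmul] at h
  have hm' (x : C) : m (comul x) = counit (R := k) x • 1 := by
    simpa [Algebra.algebraMap_eq_smul_one] using congr($hm x)
  rw [h]
  refine Finset.sum_congr rfl fun i _ ↦ ?_
  simp only [hm', TensorProduct.smul_tmul]
  rw [← map_sum, ← TensorProduct.tmul_sum, ← TensorProduct.tmul_sum, sum_counit_smul]

lemma comul_comp_antipode :
    (comul ∘ₗ antipode k : H →ₗ[k] H ⊗[k] H) =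
      TensorProduct.map (antipode k) (antipode k) ∘ₗ
        (TensorProduct.comm k H H).toLinearMap ∘ₗ comul := by
  apply WithConv.toConv_injective
  refine (left_inv_eq_right_inv (a := WithConv.toConv (comul (R := k) (A := H))) ?_
    LinearMap.comul_right_inv).symm
  ext a
  rw [(ℛ k a).convMul_apply]
  have h := sum_comul_comul_collapse (LinearMap.mul' k H ∘ₗ (antipode k).rTensor H)
    mul_antipode_rTensor_comul ((LinearMap.mul' k H ∘ₗ (antipode k).rTensor H).lTensor H ∘ₗ
      (TensorProduct.leftComm k H H H).toLinearMap) a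
  simp only [LinearMap.comp_apply, LinearMap.lTensor_tmul, LinearMap.rTensor_tmul,
    LinearEquiv.coe_coe, TensorProduct.leftComm_tmul, LinearMap.mul'_apply] at h
  rw [← TensorProduct.tmul_sum, sum_antipode_mul_eq_algebraMap_counit] at h
  convert h using 2 with i
  · simp only [LinearMap.comp_apply, LinearEquiv.coe_coe]
    conv_lhs => rw [← (ℛ k ((ℛ k a).left i)).eq, ← (ℛ k ((ℛ k a).right i)).eq]
    simp [Finset.sum_mul_sum]
  · simp [Algebra.algebraMap_eq_smul_one, Algebra.TensorProduct.one_def]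

lemma comul_antipode_symm (T : H →ₗ[k] H) (hT : T ∘ₗ antipode k = LinearMap.id)
    (hT' : antipode k ∘ₗ T = LinearMap.id) (h : H) :
    comul (T h) = ∑ i ∈ (ℛ k h).index, T ((ℛ k h).right i) ⊗ₜ[k] T ((ℛ k h).left i) := by
  have hr (x : H) : antipode k (T x) = x := congr($hT' x)
  have e := congr(TensorProduct.map T T
    ($(comul_comp_antipode (k := k) (H := H)) (T h)))
  simp only [LinearMap.comp_apply, hr, LinearEquiv.coe_coe] at e
  rw [← LinearMap.comp_apply (TensorProduct.map T T) (TensorProduct.map _ _),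
    ← TensorProduct.map_comp, hT, TensorProduct.map_id, LinearMap.id_apply, ← (ℛ k h).eq] at e
  rw [← LinearEquiv.symm_apply_eq] at e
  simpa using e.symm

lemma mul_antipode_symm_comul (T : H →ₗ[k] H) (hT : T ∘ₗ antipode k = LinearMap.id)
    (hT' : antipode k ∘ₗ T = LinearMap.id) :
    (LinearMap.mul' k H ∘ₗ T.lTensor H ∘ₗ (TensorProduct.comm k H H).toLinearMap) ∘ₗ comul =
      Algebra.linearMap k H ∘ₗ counit := by
  have hr (x : H) : antipode k (T x) = x := congr($hT' x)
  ext a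
  apply Function.LeftInverse.injective (g := T) (f := antipode k) fun x ↦ congr($hT x)
  simp only [LinearMap.comp_apply]
  rw [← (ℛ k a).eq]
  simp [antipode_mul_antidistrib, hr, sum_mul_antipode_eq_algebraMap_counit,
    Algebra.algebraMap_eq_smul_one]

lemma antipode_symm_mul_comul (T : H →ₗ[k] H) (hT : T ∘ₗ antipode k = LinearMap.id)
    (hT' : antipode k ∘ₗ T = LinearMap.id) :
    (LinearMap.mul' k H ∘ₗ T.rTensor H ∘ₗ (TensorProduct.comm k H H).toLinearMap) ∘ₗ comul =
      Algebra.linearMap k H ∘ₗ counit := by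
  have hr (x : H) : antipode k (T x) = x := congr($hT' x)
  ext a
  apply Function.LeftInverse.injective (g := T) (f := antipode k) fun x ↦ congr($hT x)
  simp only [LinearMap.comp_apply]
  rw [← (ℛ k a).eq]
  simp [antipode_mul_antidistrib, hr, sum_antipode_mul_eq_algebraMap_counit,
    Algebra.algebraMap_eq_smul_one]

lemma conv_comp_coalgHom {C D : Type} [AddCommGroup C] [Module k C] [Coalgebra k C]
    [AddCommGroup D] [Module k D] [Coalgebra k D] (f g : D →ₗ[k] k) (φ : C →ₗc[k] D) :
    conv k (f ∘ₗ φ.toLinearMap) (g ∘ₗ φ.toLinearMap) = conv k f g ∘ₗ φ.toLinearMap := by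
  exact (LinearMap.convMul_comp_coalgHom_distrib (WithConv.toConv f) (WithConv.toConv g) φ).symm

lemma conv_comp_eq_counit {C D : Type} [AddCommGroup C] [Module k C] [Coalgebra k C]
    [AddCommGroup D] [Module k D] [Coalgebra k D] {f g : D →ₗ[k] k} (h : conv k f g = counit)
    (φ : C →ₗc[k] D) :
    conv k (f ∘ₗ φ.toLinearMap) (g ∘ₗ φ.toLinearMap) = counit := by
  rw [conv_comp_coalgHom, h]
  exact φ.counit_comp

lemma conv_eq_conv_of_conv_eq_conv {C : Type} [AddCommGroup C] [Module k C] [Coalgebra k C]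
    {f g f' g' u v : C →ₗ[k] k} (h : conv k f g = conv k f' g') (hu : conv k u f' = counit)
    (hv : conv k g v = counit) : conv k u f = conv k g' v := by
  have h₁ : WithConv.toConv f * WithConv.toConv g = WithConv.toConv f' * WithConv.toConv g' :=
    congr(WithConv.toConv $h)
  have h₂ : WithConv.toConv u * WithConv.toConv f' = 1 := congr(WithConv.toConv $hu)
  have h₃ : WithConv.toConv g * WithConv.toConv v = 1 := congr(WithConv.toConv $hv)
  have : WithConv.toConv u * WithConv.toConv f = WithConv.toConv g' * WithConv.toConv v := by
    rw [← mul_one (_ * WithConv.toConv f), ← h₃, mul_assoc, ← mul_assoc _ (WithConv.toConv g), h₁,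
      ← mul_assoc, ← mul_assoc, h₂, one_mul]
  exact congr(WithConv.ofConv $this)

/-- The cocycle condition, rearranged as `σ⁻¹₁₂ * σ₂₃ = σ₁₂,₃ * σ⁻¹₁,₂₃`. -/
lemma conv_p12_p23_eq (σ σ' : H ⊗[k] H →ₗ[k] k) (hσ : IsLeftCocycle σ)
    (hσ' : IsConvInverse σ σ') :
    conv k (p12 σ') (p23 σ) = conv k (p12_3 σ) (p1_23 σ') := by
  refine conv_eq_conv_of_conv_eq_conv hσ.2 ?_ ?_
  · exact conv_comp_eq_counit hσ'.2 (Coalgebra.TensorProduct.map (CoalgHom.id k H)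
      ((Coalgebra.TensorProduct.rid k k H).toCoalgHom.comp
        (Coalgebra.TensorProduct.map (CoalgHom.id k H) (counitCoalgHom k H))))
  · exact conv_comp_eq_counit hσ'.1 (Coalgebra.TensorProduct.map (CoalgHom.id k H)
      (Bialgebra.mulCoalgHom k H))

lemma IsConvInverse.apply_tmul_one {σ σ' : H ⊗[k] H →ₗ[k] k} (hσ : IsLeftCocycle σ)
    (hσ' : IsConvInverse σ σ') (h : H) : σ' (h ⊗ₜ 1) = counit h := by
  have e := LinearMap.congr_fun hσ'.1 (h ⊗ₜ[k] (1 : H))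
  simp only [conv, LinearMap.comp_apply, TensorProduct.comul_tmul] at e
  rw [← (ℛ k h).eq] at e
  simp [Algebra.TensorProduct.one_def, TensorProduct.sum_tmul, (hσ.1 _).1] at e
  rw [← e]
  conv_lhs => rw [← sum_counit_smul (ℛ k h)]
  simp [TensorProduct.sum_tmul, ← TensorProduct.smul_tmul']

lemma conv_apply {C ι : Type} [AddCommGroup C] [Module k C] [Coalgebra k C]
    (f g : C →ₗ[k] k) {c : C} (r : Coalgebra.Repr k c ι) :
    conv k f g c = ∑ i ∈ r.index, f (r.left i) * g (r.right i) :=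
  r.convMul_apply (WithConv.toConv f) (WithConv.toConv g)

lemma conv_p12_p23_apply {ι : Type} (f g : H ⊗[k] H →ₗ[k] k) (x z : H) {y : H}
    (r : Coalgebra.Repr k y ι) :
    conv k (p12 f) (p23 g) (x ⊗ₜ (y ⊗ₜ z)) =
      ∑ i ∈ r.index, f (x ⊗ₜ r.left i) * g (r.right i ⊗ₜ z) := by
  rw [conv_apply _ _ ((ℛ k x).tmul (r.tmul (ℛ k z)))]
  simp only [Coalgebra.Repr.tmul, Finset.sum_product, p12, p23, LinearMap.comp_apply,
    TensorProduct.map_tmul, LinearMap.id_apply, LinearEquiv.coe_coe, TensorProduct.rid_tmul,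
    TensorProduct.lid_tmul, map_smul, TensorProduct.tmul_smul, smul_eq_mul]
  rw [Finset.sum_comm]
  refine Finset.sum_congr rfl fun i _ ↦ ?_
  conv_rhs => rw [← sum_counit_smul (ℛ k z)]
  conv_rhs => rw [← (TensorProduct.rid k H).apply_symm_apply x, TensorProduct.rid_symm_apply,
    ← sum_tmul_counit_eq (ℛ k x)]
  simp only [map_sum, TensorProduct.rid_tmul, TensorProduct.sum_tmul, TensorProduct.tmul_sum,
    TensorProduct.tmul_smul, ← TensorProduct.smul_tmul', map_smul, smul_eq_mul, Finset.sum_mul_sum]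
  refine Finset.sum_congr rfl fun j _ ↦ Finset.sum_congr rfl fun l _ ↦ ?_
  ring

lemma conv_p12_3_p1_23_apply {ι : Type} (f g : H ⊗[k] H →ₗ[k] k) (x z : H) {y : H}
    (r : Coalgebra.Repr k y ι) :
    conv k (p12_3 f) (p1_23 g) (x ⊗ₜ (y ⊗ₜ z)) =
      ∑ l ∈ (ℛ k z).index, ∑ i ∈ r.index, ∑ j ∈ (ℛ k x).index,
        f (((ℛ k x).left j * r.left i) ⊗ₜ (ℛ k z).left l) *
          g ((ℛ k x).right j ⊗ₜ (r.right i * (ℛ k z).right l)) := by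
  rw [conv_apply _ _ ((ℛ k x).tmul (r.tmul (ℛ k z)))]
  simp only [Coalgebra.Repr.tmul, Finset.sum_product, p12_3, p1_23, LinearMap.comp_apply,
    TensorProduct.map_tmul, LinearMap.id_apply, LinearEquiv.coe_coe,
    TensorProduct.assoc_symm_tmul, LinearMap.mul'_apply]
  exact Finset.sum_comm.trans
    ((Finset.sum_congr rfl fun _ _ ↦ Finset.sum_comm).trans Finset.sum_comm)

/-- The inverse of the antipode turns a representation of `comul h` into one of `comul (T h)`. -/
def antipodeSymmRepr (T : H →ₗ[k] H) (hT : T ∘ₗ antipode k = LinearMap.id)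
    (hT' : antipode k ∘ₗ T = LinearMap.id) (h : H) : Coalgebra.Repr k (T h) (H × H) where
  index := (ℛ k h).index
  left i := T ((ℛ k h).right i)
  right i := T ((ℛ k h).left i)
  eq := (comul_antipode_symm T hT hT' h).symm

lemma conv_eq_sum_conv_p12_p23 (f g : H ⊗[k] H →ₗ[k] k)
    (T : H →ₗ[k] H) (hT : T ∘ₗ antipode k = LinearMap.id)
    (hT' : antipode k ∘ₗ T = LinearMap.id) (a : H) :
    conv k
      (f ∘ₗ TensorProduct.map T LinearMap.id ∘ₗ (TensorProduct.comm k H H).toLinearMap ∘ₗ comul)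
      (g ∘ₗ TensorProduct.map LinearMap.id T ∘ₗ (TensorProduct.comm k H H).toLinearMap ∘ₗ comul)
      a = ∑ i ∈ (ℛ k a).index, ∑ j ∈ (ℛ k ((ℛ k a).right i)).index,
        conv k (p12 g) (p23 f) ((ℛ k ((ℛ k a).right i)).right j ⊗ₜ
          (T ((ℛ k ((ℛ k a).right i)).left j) ⊗ₜ (ℛ k a).left i)) := by
  have h := sum_comul_comul (LinearMap.mul' k k ∘ₗ
    TensorProduct.map
      (f ∘ₗ TensorProduct.map T LinearMap.id ∘ₗ (TensorProduct.comm k H H).toLinearMap)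
      (g ∘ₗ TensorProduct.map LinearMap.id T ∘ₗ (TensorProduct.comm k H H).toLinearMap) ∘ₗ
    (TensorProduct.assoc k H H (H ⊗[k] H)).symm.toLinearMap ∘ₗ
    (TensorProduct.assoc k H H H).toLinearMap.lTensor H) a
  rw [conv_apply _ _ (ℛ k a)]
  convert h using 3 with i _ i _ j
  · simp only [LinearMap.comp_apply]
    conv_lhs => rw [← (ℛ k ((ℛ k a).left i)).eq, ← (ℛ k ((ℛ k a).right i)).eq]
    simp [Finset.sum_mul_sum]
  · rw [conv_p12_p23_apply _ _ _ _ (antipodeSymmRepr T hT hT' _),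
      ← (ℛ k ((ℛ k ((ℛ k a).right i)).left j)).eq]
    simp [antipodeSymmRepr, TensorProduct.sum_tmul, TensorProduct.tmul_sum, mul_comm]

lemma sum_conv_p12_3_p1_23 (f g : H ⊗[k] H →ₗ[k] k)
    (T : H →ₗ[k] H) (hT : T ∘ₗ antipode k = LinearMap.id)
    (hT' : antipode k ∘ₗ T = LinearMap.id) (a : H) :
    ∑ i ∈ (ℛ k a).index, ∑ j ∈ (ℛ k ((ℛ k a).right i)).index,
        conv k (p12_3 f) (p1_23 g) ((ℛ k ((ℛ k a).right i)).right j ⊗ₜ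
          (T ((ℛ k ((ℛ k a).right i)).left j) ⊗ₜ (ℛ k a).left i)) =
      ∑ i ∈ (ℛ k a).index, f (1 ⊗ₜ (ℛ k a).left i) * g ((ℛ k a).right i ⊗ₜ 1) := by
  have outer := sum_comul_comul_collapse _ (antipode_symm_mul_comul T hT hT')
    (LinearMap.mul' k k ∘ₗ TensorProduct.map (f ∘ₗ TensorProduct.mk k H H 1)
      (g ∘ₗ (TensorProduct.comm k H H).toLinearMap)) a
  simp only [LinearMap.comp_apply, TensorProduct.map_tmul, LinearEquiv.coe_coe,
    TensorProduct.mk_apply, TensorProduct.comm_tmul, LinearMap.mul'_apply,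
    LinearMap.rTensor_tmul] at outer
  rw [← outer]
  refine Finset.sum_congr rfl fun i _ ↦ ?_
  simp only [conv_p12_3_p1_23_apply _ _ _ _ (antipodeSymmRepr T hT hT' _)]
  rw [Finset.sum_comm]
  refine Finset.sum_congr rfl fun l _ ↦ ?_
  have inner := sum_comul_comul_collapse _ (mul_antipode_symm_comul T hT hT')
    (LinearMap.mul' k k ∘ₗ TensorProduct.map
      (f ∘ₗ (TensorProduct.mk k H H).flip ((ℛ k ((ℛ k a).left i)).left l))
      (g ∘ₗ (LinearMap.mulRight k ((ℛ k ((ℛ k a).left i)).right l) ∘ₗ T).lTensor H) ∘ₗ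
      (TensorProduct.assoc k H H H).toLinearMap ∘ₗ
      (TensorProduct.comm k H (H ⊗[k] H)).toLinearMap) ((ℛ k a).right i)
  simpa [antipodeSymmRepr] using inner

/-- for a convolution-invertible left 2-cocycle σ on a Hopf algebra with
bijective antipode, `Σ σ⁻¹(h₄⊗S⁻¹(h₃))·σ(S⁻¹(h₂)⊗h₁) = ε(h)`, expressed as the
convolution identity `(σ∘(S⁻¹⊗id)∘τ∘Δ) * (σ⁻¹∘(id⊗S⁻¹)∘τ∘Δ) = ε` on `H`. -/
theorem stmt1 (σ σ' : H ⊗[k] H →ₗ[k] k)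
    (hσ : IsLeftCocycle σ) (hσ' : IsConvInverse σ σ')
    (Sinv : H →ₗ[k] H)
    (hS : Sinv ∘ₗ HopfAlgebra.antipode (R := k) = LinearMap.id ∧
      HopfAlgebra.antipode (R := k) ∘ₗ Sinv = LinearMap.id) :
    conv k
      (σ ∘ₗ TensorProduct.map Sinv LinearMap.id ∘ₗ (TensorProduct.comm k H H).toLinearMap ∘ₗ
        Coalgebra.comul)
      (σ' ∘ₗ TensorProduct.map LinearMap.id Sinv ∘ₗ (TensorProduct.comm k H H).toLinearMap ∘ₗ
        Coalgebra.comul)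
      = Coalgebra.counit := by
  ext a
  rw [conv_eq_sum_conv_p12_p23 σ σ' Sinv hS.1 hS.2, conv_p12_p23_eq σ σ' hσ hσ',
    sum_conv_p12_3_p1_23 σ σ' Sinv hS.1 hS.2]
  simp only [(hσ.1 _).2, hσ'.apply_tmul_one hσ]
  conv_rhs => rw [← sum_counit_smul (ℛ k a)]
  simp
end
end

section
/- Let V be an (n+1)-dimensional k-vector space with basis u,z₁,…,zₙ and symmetric bilinear form Q given by the block-diagonal matrix diag(α, L) with α≠0 and L an n×n symmetric matrix. The Clifford algebra Cl(V,Q) is ℤ₂-graded central simple (Azumaya in the graded sense) if and only if det(L)≠0, i.e., if and only if Q is nondegenerate. -/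
open scoped DirectSum

noncomputable section

namespace CliffordAlgebra

variable {k V : Type*} [Field k] [AddCommGroup V] [Module k V] {Q : QuadraticForm k V}

/-- Contraction by `polar Q v` is the graded commutator with `ι Q v`. -/
theorem contractLeft_polarBilin (v : V) (x : CliffordAlgebra Q) :
    contractLeft (Q.polarBilin v) x = ι Q v * x - involute x * ι Q v := by
  induction x using CliffordAlgebra.left_induction with
  | algebraMap r =>
    rw [contractLeft_algebraMap, AlgHom.commutes, Algebra.commutes, sub_self]
  | add x y hx hy => rw [map_add, map_add, hx, hy]; noncomm_ring
  | ι_mul x m hx =>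
    have h := ι_mul_ι_add_swap (Q := Q) v m
    rw [contractLeft_ι_mul, hx, map_mul, involute_ι, Algebra.smul_def,
      QuadraticMap.polarBilin_apply_apply, ← h]
    noncomm_ring

theorem contractLeft_mul_eq_zero {s : Set V} {d : Module.Dual k V} (hd : ∀ v ∈ s, d v = 0)
    {x : CliffordAlgebra Q} (hx : x ∈ Algebra.adjoin k (ι Q '' s)) :
    ∀ y : CliffordAlgebra Q, contractLeft d y = 0 → contractLeft d (x * y) = 0 := by
  induction hx using Algebra.adjoin_induction with
  | mem x hx =>
    obtain ⟨v, hv, rfl⟩ := hx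
    intro y hy
    rw [contractLeft_ι_mul, hd v hv, hy, zero_smul, mul_zero, sub_zero]
  | algebraMap r =>
    intro y hy
    rw [contractLeft_algebraMap_mul, hy, mul_zero]
  | add x y _ _ hx hy =>
    intro z hz
    rw [add_mul, map_add, hx z hz, hy z hz, add_zero]
  | mul x y _ _ hx hy =>
    intro z hz
    rw [mul_assoc]
    exact hx _ (hy z hz)

theorem contractLeft_eq_zero_of_mem_adjoin {s : Set V} {d : Module.Dual k V}
    (hd : ∀ v ∈ s, d v = 0) {x : CliffordAlgebra Q} (hx : x ∈ Algebra.adjoin k (ι Q '' s)) :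
    contractLeft d x = 0 := by
  simpa using contractLeft_mul_eq_zero hd hx 1 (contractLeft_one ..)

/-- Normal form with respect to one additional generator. -/
theorem exists_eq_add_ι_mul_of_mem_adjoin_insert {s : Set V} {v : V} {x : CliffordAlgebra Q}
    (hx : x ∈ Algebra.adjoin k (ι Q '' insert v s)) :
    ∃ a ∈ Algebra.adjoin k (ι Q '' s), ∃ b ∈ Algebra.adjoin k (ι Q '' s),
      x = a + ι Q v * b := by
  set A := Algebra.adjoin k (ι Q '' s) with hA
  suffices h : ∀ a ∈ A, ∀ b ∈ A, ∃ a' ∈ A, ∃ b' ∈ A,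
      x * (a + ι Q v * b) = a' + ι Q v * b' by
    simpa using h 1 A.one_mem 0 A.zero_mem
  induction hx using Algebra.adjoin_induction with
  | mem x hx =>
    obtain ⟨w, hw, rfl⟩ := hx
    intro a ha b hb
    rcases hw with rfl | hw
    · refine ⟨Q w • b, A.smul_mem hb _, a, ha, ?_⟩
      rw [mul_add, ← mul_assoc, ι_sq_scalar, Algebra.smul_def, add_comm]
    · have hwA : ι Q w ∈ A := Algebra.subset_adjoin ⟨w, hw, rfl⟩
      refine ⟨ι Q w * a + QuadraticMap.polar Q w v • b,
        A.add_mem (A.mul_mem hwA ha) (A.smul_mem hb _), -(ι Q w * b),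
        A.neg_mem (A.mul_mem hwA hb), ?_⟩
      rw [Algebra.smul_def, ← ι_mul_ι_add_swap]
      noncomm_ring
  | algebraMap r =>
    intro a ha b hb
    refine ⟨r • a, A.smul_mem ha _, r • b, A.smul_mem hb _, ?_⟩
    rw [← Algebra.smul_def, smul_add, mul_smul_comm]
  | add x y _ _ hx hy =>
    intro a ha b hb
    obtain ⟨a₁, ha₁, b₁, hb₁, h₁⟩ := hx a ha b hb
    obtain ⟨a₂, ha₂, b₂, hb₂, h₂⟩ := hy a ha b hb
    refine ⟨a₁ + a₂, A.add_mem ha₁ ha₂, b₁ + b₂, A.add_mem hb₁ hb₂, ?_⟩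
    rw [add_mul, h₁, h₂]
    noncomm_ring
  | mul x y _ _ hx hy =>
    intro a ha b hb
    obtain ⟨a₁, ha₁, b₁, hb₁, h₁⟩ := hy a ha b hb
    rw [mul_assoc, h₁]
    exact hx a₁ ha₁ b₁ hb₁

/-- The contraction dual to a generator detects whether that generator occurs. -/
theorem contractLeft_mem_adjoin_and {s : Set V} {v : V} {d : Module.Dual k V}
    (hd : ∀ w ∈ s, d w = 0) (hv : d v = 1) {x : CliffordAlgebra Q}
    (hx : x ∈ Algebra.adjoin k (ι Q '' insert v s)) :
    contractLeft d x ∈ Algebra.adjoin k (ι Q '' s) ∧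
      (contractLeft d x = 0 → x ∈ Algebra.adjoin k (ι Q '' s)) := by
  obtain ⟨a, ha, b, hb, rfl⟩ := exists_eq_add_ι_mul_of_mem_adjoin_insert hx
  have h : contractLeft d (a + ι Q v * b) = b := by
    rw [map_add, contractLeft_ι_mul, contractLeft_eq_zero_of_mem_adjoin hd ha,
      contractLeft_eq_zero_of_mem_adjoin hd hb, hv, one_smul, mul_zero, sub_zero, zero_add]
  rw [h]
  refine ⟨hb, ?_⟩
  rintro rfl
  simpa using ha

theorem adjoin_ι_image_range_basis {κ : Type*} (b : Module.Basis κ k V) :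
    Algebra.adjoin k (ι Q '' Set.range b) = ⊤ := by
  rw [eq_top_iff, ← adjoin_range_ι]
  refine Algebra.adjoin_le ?_
  rintro _ ⟨v, rfl⟩
  refine Algebra.span_le_adjoin k _ ?_
  rw [← Submodule.map_span, b.span_eq]
  exact ⟨v, trivial, rfl⟩

/-- Only scalars are killed by every contraction. -/
theorem exists_algebraMap_of_contractLeft_eq_zero [FiniteDimensional k V] {x : CliffordAlgebra Q}
    (hx : ∀ d : Module.Dual k V, contractLeft d x = 0) : ∃ t : k, x = algebraMap k _ t := by
  classical
  let b := Module.finBasis k V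
  have key : ∀ s : Finset (Fin (Module.finrank k V)),
      x ∈ Algebra.adjoin k (ι Q '' (b '' s)) → ∃ t : k, x = algebraMap k _ t := by
    intro s
    induction s using Finset.induction_on with
    | empty =>
      intro h
      simp only [Finset.coe_empty, Set.image_empty, Algebra.adjoin_empty, Algebra.mem_bot] at h
      exact h.imp fun _ => Eq.symm
    | insert i s hi ih =>
      intro h
      rw [Finset.coe_insert, Set.image_insert_eq] at h
      refine ih ((contractLeft_mem_adjoin_and (d := b.coord i) ?_ (by simp) h).2 (hx _))
      rintro _ ⟨j, hj, rfl⟩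
      rw [b.coord_apply, b.repr_self, Finsupp.single_eq_of_ne]
      rintro rfl
      exact hi hj
  refine key Finset.univ ?_
  rw [Finset.coe_univ, Set.image_univ, adjoin_ι_image_range_basis]
  trivial

/-- A subset stable under contractions with a nonzero element contains a nonzero scalar. -/
theorem exists_algebraMap_mem_of_contractLeft_mem [FiniteDimensional k V]
    {I : Set (CliffordAlgebra Q)} (hI : ∀ d : Module.Dual k V, ∀ x ∈ I, contractLeft d x ∈ I)
    {x : CliffordAlgebra Q} (hxI : x ∈ I) (hx : x ≠ 0) : ∃ t : k, t ≠ 0 ∧ algebraMap k _ t ∈ I := by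
  classical
  let b := Module.finBasis k V
  have key : ∀ (s : Finset (Fin (Module.finrank k V))) (x : CliffordAlgebra Q), x ∈ I → x ≠ 0 →
      x ∈ Algebra.adjoin k (ι Q '' (b '' s)) → ∃ t : k, t ≠ 0 ∧ algebraMap k _ t ∈ I := by
    intro s
    induction s using Finset.induction_on with
    | empty =>
      intro x hxI hx h
      simp only [Finset.coe_empty, Set.image_empty, Algebra.adjoin_empty, Algebra.mem_bot] at h
      obtain ⟨t, rfl⟩ := h
      refine ⟨t, ?_, hxI⟩
      rintro rfl
      exact hx (map_zero _)
    | insert i s hi ih =>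
      intro x hxI hx h
      rw [Finset.coe_insert, Set.image_insert_eq] at h
      have hc := contractLeft_mem_adjoin_and (d := b.coord i) ?_ (by simp) h
      · by_cases h0 : contractLeft (b.coord i) x = 0
        · exact ih x hxI hx (hc.2 h0)
        · exact ih _ (hI _ x hxI) h0 hc.1
      · rintro _ ⟨j, hj, rfl⟩
        rw [b.coord_apply, b.repr_self, Finsupp.single_eq_of_ne]
        rintro rfl
        exact hi hj
  refine key Finset.univ x hxI hx ?_
  rw [Finset.coe_univ, Set.image_univ, adjoin_ι_image_range_basis]
  trivial

theorem involute_eq_decompose_sub (x : CliffordAlgebra Q) :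
    involute x = (DirectSum.decompose (evenOdd Q) x 0 : CliffordAlgebra Q) -
      (DirectSum.decompose (evenOdd Q) x 1 : CliffordAlgebra Q) := by
  classical
  have h : x = (DirectSum.decompose (evenOdd Q) x 0 : CliffordAlgebra Q) +
      (DirectSum.decompose (evenOdd Q) x 1 : CliffordAlgebra Q) := by
    conv_lhs => rw [← DirectSum.sum_support_decompose (evenOdd Q) x]
    rw [Finset.sum_subset (Finset.subset_univ _)
      (fun i _ hi => by simpa [DFinsupp.notMem_support_iff] using hi)]
    exact Fin.sum_univ_two _
  conv_lhs => rw [h]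
  rw [map_add, involute_eq_of_mem_even (SetLike.coe_mem _),
    involute_eq_of_mem_odd (SetLike.coe_mem _), sub_eq_add_neg]

/-- The graded centre of a Clifford algebra of a nondegenerate form consists of scalars. -/
theorem exists_algebraMap_of_gradedCentral [FiniteDimensional k V]
    (hQ : Q.polarBilin.Nondegenerate) {i : ZMod 2} {z : CliffordAlgebra Q} (hz : z ∈ evenOdd Q i)
    (hcomm : ∀ v : V, z * ι Q v = if i = 1 then -(ι Q v * z) else ι Q v * z) :
    ∃ t : k, z = algebraMap k _ t := by
  refine exists_algebraMap_of_contractLeft_eq_zero fun d => ?_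
  obtain ⟨v, rfl⟩ := (LinearMap.BilinForm.toDual Q.polarBilin hQ).surjective d
  change contractLeft (Q.polarBilin v) z = 0
  rw [contractLeft_polarBilin]
  have h := hcomm v
  obtain rfl | rfl := (by decide : ∀ i : ZMod 2, i = 0 ∨ i = 1) i
  · rw [involute_eq_of_mem_even hz, h]
    simp
  · rw [involute_eq_of_mem_odd hz, neg_mul, h]
    simp

/-- The Clifford algebra of a nondegenerate form has no nontrivial graded ideals. -/
theorem eq_bot_or_eq_top_of_graded [FiniteDimensional k V]
    (hQ : Q.polarBilin.Nondegenerate) (I : TwoSidedIdeal (CliffordAlgebra Q))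
    (hI : ∀ x ∈ I, ∀ i : ZMod 2, (DirectSum.decompose (evenOdd Q) x i : CliffordAlgebra Q) ∈ I) :
    I = ⊥ ∨ I = ⊤ := by
  by_cases h : ∃ x ∈ I, x ≠ 0
  · right
    obtain ⟨x, hxI, hx⟩ := h
    have hc : ∀ d : Module.Dual k V, ∀ x ∈ I, contractLeft d x ∈ I := by
      intro d x hx
      obtain ⟨v, rfl⟩ := (LinearMap.BilinForm.toDual Q.polarBilin hQ).surjective d
      change contractLeft (Q.polarBilin v) x ∈ I
      rw [contractLeft_polarBilin, involute_eq_decompose_sub]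
      exact I.sub_mem (I.mul_mem_left _ _ hx)
        (I.mul_mem_right _ _ (I.sub_mem (hI x hx 0) (hI x hx 1)))
    obtain ⟨t, ht, htI⟩ := exists_algebraMap_mem_of_contractLeft_mem
      (I := (I : Set (CliffordAlgebra Q))) hc hxI hx
    rw [← TwoSidedIdeal.one_mem_iff]
    have := I.mul_mem_left (algebraMap k _ t⁻¹) _ htI
    rwa [← map_mul, inv_mul_cancel₀ ht, map_one] at this
  · left
    push Not at h
    refine le_bot_iff.mp fun x hx => ?_
    rw [h x hx]
    exact (⊥ : TwoSidedIdeal _).zero_mem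

/-- A radical vector lies in the graded centre. -/
theorem mul_ι_of_polar_eq_zero {v : V} (hv : ∀ w, QuadraticMap.polar Q v w = 0) {j : ZMod 2}
    {a : CliffordAlgebra Q} (ha : a ∈ evenOdd Q j) :
    ι Q v * a = if j = 1 then -(a * ι Q v) else a * ι Q v := by
  have h0 : Q.polarBilin v = 0 := LinearMap.ext hv
  have h := contractLeft_polarBilin v a
  rw [h0, map_zero, LinearMap.zero_apply, eq_comm, sub_eq_zero] at h
  obtain rfl | rfl := (by decide : ∀ i : ZMod 2, i = 0 ∨ i = 1) j
  · rw [h, involute_eq_of_mem_even ha]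
    simp
  · rw [h, involute_eq_of_mem_odd ha]
    simp

theorem ι_ne_algebraMap (h2 : (2 : k) ≠ 0) {v : V} (hv : v ≠ 0) (t : k) :
    ι Q v ≠ algebraMap k _ t := by
  have : Invertible (2 : k) := invertibleOfNonzero h2
  intro h
  refine hv ((Module.forall_dual_apply_eq_zero_iff k v).mp fun d => ?_)
  have hc := congrArg (contractLeft d) h
  rw [contractLeft_ι, contractLeft_algebraMap] at hc
  exact (map_eq_zero _).mp hc

end CliffordAlgebra

theorem Matrix.IsSymm.polarBilin_toQuadraticForm' {k m : Type*} [Field k] [Fintype m]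
    [DecidableEq m] {M : Matrix m m k} (hM : M.IsSymm) :
    QuadraticMap.polarBilin M.toQuadraticForm' = ((2 : k) • M).toBilin' := by
  refine LinearMap.ext₂ fun x y => ?_
  rw [QuadraticMap.polarBilin_apply_apply, Matrix.toQuadraticForm',
    LinearMap.BilinMap.polar_toQuadraticMap,
    Matrix.toLinearMap₂'_apply', Matrix.toLinearMap₂'_apply', Matrix.toBilin'_apply',
    Matrix.dotProduct_mulVec y, ← Matrix.mulVec_transpose, hM.eq, dotProduct_comm (M.mulVec y),
    Matrix.smul_mulVec, dotProduct_smul, smul_eq_mul, two_mul]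

/-- for the Clifford algebra of the symmetric bilinear form with Gram
matrix `diag(α, L)` (`α ≠ 0`, `L` symmetric, char k ≠ 2) on the `(n+1)`-dimensional
space with basis `u,z₁,…,zₙ`, being ℤ₂-graded central simple (graded center `k`, no
nontrivial graded two-sided ideals) is equivalent to `det L ≠ 0`, i.e. to
nondegeneracy of the form. -/
theorem stmt17 {k : Type} [Field k] (hchar : (2 : k) ≠ 0)
    (n : ℕ) (α : k) (hα : α ≠ 0) (L : Matrix (Fin n) (Fin n) k) (hL : L.IsSymm) :
    (let M : Matrix (Fin 1 ⊕ Fin n) (Fin 1 ⊕ Fin n) k :=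
      Matrix.fromBlocks (Matrix.diagonal fun _ => α) 0 0 L
    let Q : QuadraticForm k ((Fin 1 ⊕ Fin n) → k) := M.toQuadraticMap'
    let C := CliffordAlgebra Q
    let gradedCentralSimple : Prop :=
      -- the graded center is k …
      (∀ (i : ZMod 2) (z : C), z ∈ CliffordAlgebra.evenOdd Q i →
        (∀ (j : ZMod 2) (a : C), a ∈ CliffordAlgebra.evenOdd Q j →
          z * a = if i = 1 ∧ j = 1 then -(a * z) else a * z) →
        ∃ t : k, z = algebraMap k C t) ∧
      -- … and every graded two-sided ideal is trivial
      (∀ I : TwoSidedIdeal C,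
        (∀ x ∈ I, ∀ i : ZMod 2,
          (DirectSum.decompose (CliffordAlgebra.evenOdd Q) x i : C) ∈ I) →
        I = ⊥ ∨ I = ⊤)
    (gradedCentralSimple ↔ L.det ≠ 0) ∧
    (gradedCentralSimple ↔ (QuadraticMap.polarBilin Q).Nondegenerate)) := by
  intro M Q C P
  have hM : M.IsSymm := by
    refine Matrix.IsSymm.fromBlocks (Matrix.isSymm_diagonal _) (by simp) hL
  have hdet : (QuadraticMap.polarBilin Q).Nondegenerate ↔ L.det ≠ 0 := by
    have hMd : M.det = α * L.det := by simp [M]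
    rw [show QuadraticMap.polarBilin Q = _ from hM.polarBilin_toQuadraticForm',
      ← LinearMap.BilinForm.Nondegenerate,
      LinearMap.BilinForm.nondegenerate_toBilin'_iff_det_ne_zero, Matrix.det_smul, hMd]
    simp [hα, hchar]
  have hP : P ↔ (QuadraticMap.polarBilin Q).Nondegenerate := by
    constructor
    · rintro ⟨hcentre, -⟩
      have hrad : ∀ v, (∀ w, QuadraticMap.polar Q v w = 0) → v = 0 := by
        intro v hv
        by_contra hv0
        obtain ⟨t, ht⟩ := hcentre 1 _ (CliffordAlgebra.ι_mem_evenOdd_one Q v) fun j a ha => by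
          simpa using CliffordAlgebra.mul_ι_of_polar_eq_zero hv ha
        exact CliffordAlgebra.ι_ne_algebraMap hchar hv0 t ht
      refine ⟨hrad, fun v hv => hrad v fun w => ?_⟩
      rw [QuadraticMap.polar_comm]
      exact hv w
    · intro hQ
      refine ⟨fun i z hz h => ?_, CliffordAlgebra.eq_bot_or_eq_top_of_graded hQ⟩
      refine CliffordAlgebra.exists_algebraMap_of_gradedCentral hQ hz fun v => ?_
      simpa using h 1 _ (CliffordAlgebra.ι_mem_evenOdd_one Q v)
  exact ⟨hP.trans hdet, hP⟩
end
end
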